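/- arXiv:2602.02599 — 2 statements merged into one kernel-verified Lean document; each statement's English description precedes it below -/
import Mathlib

section
/- Let D = 2n, let R_t ∈ ℝ^{D×D} be the RoPE rotation at position t, i.e., the block-diagonal matrix whose j-th 2×2 block on the coordinate pair (2j−1, 2j) is the planar rotation by angle t·θ_j (entries [[cos(tθ_j), −sin(tθ_j)], [sin(tθ_j), cos(tθ_j)]]) for fixed frequencies θ_1,…,θ_n ∈ ℝ. Let S ⊆ {1,…,n} with |S| = m, let B ∈ ℝ^{2m×D} be the binary pair-preserving expansion matrix of S, and let R'_t ∈ ℝ^{2m×2m} be the index-aware restricted RoPE rotation, block-diagonal with the blocks of R_t for p ∈ S in increasing order. Then for every matrix Y ∈ ℝ^{s×2m} and every position t, (Y R'_t) B = (Y B) R_t. In particular, RAP's factorization satisfies RoPE-commutativity: for any X ∈ ℝ^{s×d} and A ∈ ℝ^{d×2m}, RoPE'_t(X A) B = RoPE_t(X A B), where RoPE_t(Z) := Z R_t and RoPE'_t(Z) := Z R'_t. -/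
open Matrix

noncomputable section

/-- The index of the pair containing coordinate `i` (coordinates `2p, 2p+1` form pair `p`,
0-indexed; this corresponds to the pair `(2p-1, 2p)` in 1-indexed notation). -/
def pairIdx {m : ℕ} (i : Fin (2 * m)) : Fin m :=
  ⟨i.val / 2, by have := i.isLt; omega⟩

/-- Original coordinate index of the `i`-th retained coordinate, when the retained pairs are
given (in increasing order) by a strictly monotone map `e : Fin m → Fin n`. -/
def retIdx {m n : ℕ} (e : Fin m → Fin n) (i : Fin (2 * m)) : Fin (2 * n) :=
  ⟨2 * (e (pairIdx i)).val + i.val % 2, by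
    have h1 := (e (pairIdx i)).isLt; omega⟩

/-- The binary pair-preserving expansion matrix `B ∈ ℝ^{2m × 2n}`:
`B i j = 1` iff `j` is the original coordinate index of the `i`-th retained coordinate. -/
def expandMat {m n : ℕ} (e : Fin m → Fin n) : Matrix (Fin (2 * m)) (Fin (2 * n)) ℝ :=
  fun i j => if j = retIdx e i then 1 else 0

/-- Block-diagonal matrix whose `p`-th 2×2 diagonal block (acting on the coordinate pair
`(2p, 2p+1)`) is `Rb p`. -/
def blockDiagMat {n : ℕ} (Rb : Fin n → Matrix (Fin 2) (Fin 2) ℝ) :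
    Matrix (Fin (2 * n)) (Fin (2 * n)) ℝ :=
  fun i j =>
    if i.val / 2 = j.val / 2 then
      Rb (pairIdx i) ⟨i.val % 2, by omega⟩ ⟨j.val % 2, by omega⟩
    else 0

/-- 2×2 planar rotation by angle `a`, in the row-vector convention
`[[cos a, -sin a], [sin a, cos a]]`. -/
def rotBlock (a : ℝ) : Matrix (Fin 2) (Fin 2) ℝ :=
  !![Real.cos a, -Real.sin a; Real.sin a, Real.cos a]

/-- The RoPE rotation matrix at position `t` with frequencies `θ`: block-diagonal with the
planar rotation by angle `t * θ j` on the `j`-th coordinate pair. -/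
def ropeMat {n : ℕ} (θ : Fin n → ℝ) (t : ℝ) : Matrix (Fin (2 * n)) (Fin (2 * n)) ℝ :=
  blockDiagMat fun j => rotBlock (t * θ j)

theorem pairIdx_retIdx {m n : ℕ} (e : Fin m → Fin n) (i : Fin (2 * m)) :
    pairIdx (retIdx e i) = e (pairIdx i) := by
  ext
  simp only [pairIdx, retIdx]
  omega

theorem retIdx_mod_two {m n : ℕ} (e : Fin m → Fin n) (i : Fin (2 * m)) :
    (retIdx e i).val % 2 = i.val % 2 := by
  simp only [retIdx]
  omega

theorem blockDiagMat_apply {n : ℕ} (Rb : Fin n → Matrix (Fin 2) (Fin 2) ℝ)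
    (i j : Fin (2 * n)) :
    blockDiagMat Rb i j = if pairIdx i = pairIdx j then
      Rb (pairIdx i) ⟨i.val % 2, by omega⟩ ⟨j.val % 2, by omega⟩ else 0 := by
  simp only [blockDiagMat, pairIdx, Fin.mk.injEq]

theorem expandMat_mul_apply {m n : ℕ} {κ : Type*} (e : Fin m → Fin n)
    (M : Matrix (Fin (2 * n)) κ ℝ) (i : Fin (2 * m)) (k : κ) :
    (expandMat e * M) i k = M (retIdx e i) k := by
  simp [Matrix.mul_apply, expandMat]

/-- Restricting a block-diagonal matrix to the retained pairs commutes with expansion. -/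
theorem blockDiagMat_comp_mul_expandMat {m n : ℕ} (e : Fin m → Fin n)
    (Rb : Fin n → Matrix (Fin 2) (Fin 2) ℝ) :
    blockDiagMat (fun p => Rb (e p)) * expandMat e = expandMat e * blockDiagMat Rb := by
  ext i k
  rw [expandMat_mul_apply, blockDiagMat_apply, pairIdx_retIdx, Matrix.mul_apply]
  split_ifs with hk
  · have hi := i.isLt
    let j₀ : Fin (2 * m) := ⟨2 * (i.val / 2) + k.val % 2, by omega⟩
    have hpair : pairIdx i = pairIdx j₀ := by
      ext
      simp only [pairIdx, j₀]
      omega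
    have hmod : j₀.val % 2 = k.val % 2 := by
      simp only [j₀]
      omega
    have hret : k = retIdx e j₀ := by
      ext
      simp only [retIdx, ← hpair, hk, hmod]
      simp only [pairIdx]
      omega
    rw [Finset.sum_eq_single j₀]
    · rw [blockDiagMat_apply, if_pos hpair, expandMat, if_pos hret, mul_one]
      simp only [retIdx_mod_two, hmod]
    · intro j _ hj
      rw [blockDiagMat_apply, expandMat]
      split_ifs with hij hjk
      · refine absurd (Fin.ext ?_) hj
        have hdiv : i.val / 2 = j.val / 2 := congrArg Fin.val hij
        have hkj := retIdx_mod_two e j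
        rw [← hjk] at hkj
        simp only [j₀]
        omega
      all_goals simp
    · simp
  · refine Finset.sum_eq_zero fun j _ => ?_
    rw [blockDiagMat_apply, expandMat]
    split_ifs with hij hjk
    · exact absurd (by rw [hjk, pairIdx_retIdx, hij]) hk
    all_goals simp

theorem ropeMat_comp_mul_expandMat {m n : ℕ} (e : Fin m → Fin n) (θ : Fin n → ℝ) (t : ℝ) :
    ropeMat (fun p => θ (e p)) t * expandMat e = expandMat e * ropeMat θ t :=
  blockDiagMat_comp_mul_expandMat e fun j => rotBlock (t * θ j)

/-- The RoPE rotation commutes with the binary pair-preserving expansion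
matrix: `(Y R'_t) B = (Y B) R_t` for every `Y`, where `R'_t` is the index-aware restricted
RoPE rotation (using the original frequencies `θ (e p)` of the retained pairs).
In particular, RAP's factorization satisfies RoPE-commutativity:
`RoPE'_t(X A) B = RoPE_t(X A B)` for all `X` and `A`. -/
theorem rap_rope_commutativity {n m : ℕ} (e : Fin m → Fin n) (he : StrictMono e)
    (θ : Fin n → ℝ) (t : ℝ) :
    (∀ (s : ℕ) (Y : Matrix (Fin s) (Fin (2 * m)) ℝ),
      Y * ropeMat (fun p => θ (e p)) t * expandMat e = Y * expandMat e * ropeMat θ t) ∧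
    (∀ (s d : ℕ) (X : Matrix (Fin s) (Fin d) ℝ) (A : Matrix (Fin d) (Fin (2 * m)) ℝ),
      (X * A) * ropeMat (fun p => θ (e p)) t * expandMat e
        = (X * A * expandMat e) * ropeMat θ t) := by
  constructor
  · intro s Y
    rw [Matrix.mul_assoc, ropeMat_comp_mul_expandMat, Matrix.mul_assoc]
  · intro s d X A
    rw [Matrix.mul_assoc, ropeMat_comp_mul_expandMat, Matrix.mul_assoc (X * A)]
end
end

section
/- Let D = 2n with RoPE rotations R_i ∈ ℝ^{D×D} (block-diagonal planar rotations of angles i·θ_j on pairs (2j−1,2j)), let S ⊆ {1,…,n} with |S| = m, let B ∈ ℝ^{2m×D} be the binary pair-preserving expansion matrix of S, and let R'_i ∈ ℝ^{2m×2m} be the corresponding index-aware restricted rotation. Then for every query row vector q ∈ ℝ^{1×D} at position i and every latent key row vector k ∈ ℝ^{1×2m} at position t, the attention score computed with full-dimensional reconstruction equals the score computed entirely in the latent dimension: (q R_i) (k B R_t)ᵀ = (q Bᵀ R'_i) (k R'_t)ᵀ. Consequently, absorbing Bᵀ into the query projection (W̃_q := W_q Bᵀ) leaves all attention scores unchanged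 while both projections become (2m)-dimensional. -/
open Matrix

noncomputable section

theorem transpose_blockDiagMat {n : ℕ} (Rb : Fin n → Matrix (Fin 2) (Fin 2) ℝ) :
    (blockDiagMat Rb)ᵀ = blockDiagMat fun p => (Rb p)ᵀ := by
  ext a b
  by_cases h : a.val / 2 = b.val / 2
  · have hp : pairIdx b = pairIdx a := Fin.ext h.symm
    simp [blockDiagMat, h, hp]
  · simp [blockDiagMat, h, Ne.symm h]

/-- Pair-preserving expansion intertwines a block-diagonal matrix with its restriction to the
retained pairs. -/
theorem expandMat_mul_blockDiagMat {n m : ℕ} (e : Fin m → Fin n)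
    (Rb : Fin n → Matrix (Fin 2) (Fin 2) ℝ) :
    expandMat e * blockDiagMat Rb = blockDiagMat (fun p => Rb (e p)) * expandMat e := by
  ext a j
  have ha := a.isLt
  have hdiv (b : Fin (2 * m)) : (retIdx e b).val / 2 = (e (pairIdx b)).val := by
    simp only [retIdx]; omega
  have hmod (b : Fin (2 * m)) : (retIdx e b).val % 2 = b.val % 2 := by
    simp only [retIdx]; omega
  have hpair : pairIdx (retIdx e a) = e (pairIdx a) := Fin.ext (hdiv a)
  have hL : (expandMat e * blockDiagMat Rb) a j = blockDiagMat Rb (retIdx e a) j := by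
    simp [Matrix.mul_apply, expandMat]
  rw [hL, Matrix.mul_apply]
  by_cases h : (e (pairIdx a)).val = j.val / 2
  · let b : Fin (2 * m) := ⟨2 * (a.val / 2) + j.val % 2, by omega⟩
    have hab : a.val / 2 = b.val / 2 := by simp only [b]; omega
    have hbmod : b.val % 2 = j.val % 2 := by simp only [b]; omega
    have hpb : pairIdx b = pairIdx a := Fin.ext hab.symm
    have hj : j = retIdx e b := by
      apply Fin.ext
      simp only [retIdx, hpb, hbmod]
      omega
    rw [Finset.sum_eq_single b]
    · simp only [blockDiagMat, expandMat, hdiv, hmod, hpair, hbmod]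
      rw [if_pos h, if_pos hab, if_pos hj, mul_one]
    · intro c _ hc
      by_cases hac : a.val / 2 = c.val / 2
      · have hjc : j ≠ retIdx e c := by
          intro hjc
          have := hmod c
          rw [← hjc] at this
          exact hc (Fin.ext (by omega))
        simp [expandMat, hjc]
      · simp [blockDiagMat, hac]
    · simp
  · rw [Finset.sum_eq_zero]
    · simp [blockDiagMat, hdiv, h]
    · intro c _
      by_cases hac : a.val / 2 = c.val / 2
      · have hjc : j ≠ retIdx e c := by
          intro hjc
          have hpc : pairIdx c = pairIdx a := Fin.ext hac.symm
          have := hdiv c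
          rw [← hjc, hpc] at this
          exact h this.symm
        simp [expandMat, hjc]
      · simp [blockDiagMat, hac]

theorem blockDiagMat_mul_transpose_expandMat {n m : ℕ} (e : Fin m → Fin n)
    (Rb : Fin n → Matrix (Fin 2) (Fin 2) ℝ) :
    blockDiagMat Rb * (expandMat e)ᵀ = (expandMat e)ᵀ * blockDiagMat (fun p => Rb (e p)) := by
  apply Matrix.transpose_injective
  simp only [Matrix.transpose_mul, Matrix.transpose_transpose, transpose_blockDiagMat]
  exact expandMat_mul_blockDiagMat e fun p => (Rb p)ᵀ

theorem rope_score_expandMat {n m l : ℕ} (e : Fin m → Fin n) (θ : Fin n → ℝ) (i t : ℝ)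
    (q : Matrix (Fin l) (Fin (2 * n)) ℝ) (k : Matrix (Fin l) (Fin (2 * m)) ℝ) :
    (q * ropeMat θ i) * (k * expandMat e * ropeMat θ t)ᵀ
      = (q * (expandMat e)ᵀ * ropeMat (fun p => θ (e p)) i)
          * (k * ropeMat (fun p => θ (e p)) t)ᵀ := by
  have hk : expandMat e * ropeMat θ t = ropeMat (fun p => θ (e p)) t * expandMat e :=
    expandMat_mul_blockDiagMat e _
  have hq : ropeMat θ i * (expandMat e)ᵀ = (expandMat e)ᵀ * ropeMat (fun p => θ (e p)) i :=
    blockDiagMat_mul_transpose_expandMat e _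
  rw [Matrix.mul_assoc k, hk, ← Matrix.mul_assoc k, Matrix.transpose_mul _ (expandMat e),
    ← Matrix.mul_assoc, Matrix.mul_assoc q, hq, ← Matrix.mul_assoc q]

/-- For a query row `q ∈ ℝ^{1×D}` at position `i` and a latent key row
`k ∈ ℝ^{1×2m}` at position `t`, the attention score computed with full-dimensional
reconstruction equals the score computed entirely in the latent dimension:
`(q R_i)(k B R_t)ᵀ = (q Bᵀ R'_i)(k R'_t)ᵀ`.  Consequently, absorbing `Bᵀ` into the query
projection (`W̃_q := W_q Bᵀ`) leaves all attention scores unchanged. -/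
theorem rap_attention_score_invariance {n m : ℕ} (e : Fin m → Fin n) (he : StrictMono e)
    (θ : Fin n → ℝ) (i t : ℝ)
    (q : Matrix (Fin 1) (Fin (2 * n)) ℝ) (k : Matrix (Fin 1) (Fin (2 * m)) ℝ) :
    (q * ropeMat θ i) * (k * expandMat e * ropeMat θ t)ᵀ
      = (q * (expandMat e)ᵀ * ropeMat (fun p => θ (e p)) i)
          * (k * ropeMat (fun p => θ (e p)) t)ᵀ ∧
    (∀ (d : ℕ) (Wq : Matrix (Fin d) (Fin (2 * n)) ℝ) (x : Matrix (Fin 1) (Fin d) ℝ),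
      (x * Wq * ropeMat θ i) * (k * expandMat e * ropeMat θ t)ᵀ
        = (x * (Wq * (expandMat e)ᵀ) * ropeMat (fun p => θ (e p)) i)
            * (k * ropeMat (fun p => θ (e p)) t)ᵀ) := by
  refine ⟨rope_score_expandMat e θ i t q k, fun d Wq x => ?_⟩
  rw [← Matrix.mul_assoc x]
  exact rope_score_expandMat e θ i t (x * Wq) k
end
end
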